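/- arXiv:0706.1973 — 2 statements merged into one kernel-verified Lean document; each statement's English description precedes it below -/
import Mathlib

section
/- The quadruple (B1, B2, B3, B4) is a 4-(109; 54, 57, 60, 63; 125) supplementary difference set in Z_109; that is, |B1| = 54, |B2| = 57, |B3| = 60, |B4| = 63, and for every nonzero d ∈ Z_109, the total number of ordered pairs (x, y) with x, y ∈ B_i and x − y = d, summed over i = 1, 2, 3, 4, equals 125. -/
open Finset Matrix

/-- The subgroup H of order 3 of the multiplicative group of `ZMod 109`. -/
def H : Finset (ZMod 109) := {1, 45, 63}

/-- Representatives of the even-indexed orbits. -/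
def rep : List (ZMod 109) := [1, 2, 3, 4, 5, 6, 8, 9, 10, 11, 13, 15, 16, 18, 20, 23, 25, 30]

/-- The orbits `α i`: `α (2*i) = rep[i] • H` and `α (2*i+1) = -α (2*i)`. -/
def alpha (i : ℕ) : Finset (ZMod 109) :=
  if i % 2 = 0 then H.image (fun h => rep.getD (i / 2) 0 * h)
  else (H.image (fun h => rep.getD (i / 2) 0 * h)).image (fun x => -x)

def B1 : Finset (ZMod 109) := ({0, 3, 5, 6, 9, 10, 13, 15, 16, 18, 21, 23, 24, 27, 28, 30, 32, 34} : Finset ℕ).biUnion alpha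
def B2 : Finset (ZMod 109) := ({1, 4, 5, 6, 7, 8, 10, 11, 12, 13, 16, 19, 20, 21, 25, 27, 30, 31, 34} : Finset ℕ).biUnion alpha
def B3 : Finset (ZMod 109) := ({0, 1, 2, 3, 4, 6, 10, 12, 13, 15, 16, 17, 20, 22, 23, 24, 25, 29, 34, 35} : Finset ℕ).biUnion alpha
def B4 : Finset (ZMod 109) := ({0, 1, 2, 3, 5, 8, 9, 12, 13, 14, 15, 16, 19, 21, 23, 25, 26, 28, 29, 33, 34} : Finset ℕ).biUnion alpha

/-- Ordered pairs in `B` with difference `d` correspond to the `x ∈ B` with `x - d ∈ B`. -/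
theorem card_filter_sub_eq {G : Type*} [AddCommGroup G] [DecidableEq G] (B : Finset G) (d : G) :
    ((B ×ˢ B).filter (fun p => p.1 - p.2 = d)).card = (B.filter (fun x => x - d ∈ B)).card := by
  refine Finset.card_bij' (fun p _ => p.1) (fun x _ => (x, x - d)) ?_ ?_ ?_ ?_
  · rintro ⟨x, y⟩ h
    simp only [mem_filter, mem_product] at h ⊢
    obtain ⟨⟨hx, hy⟩, rfl⟩ := h
    simpa using ⟨hx, hy⟩
  · intro x h
    simp only [mem_filter, mem_product] at h ⊢
    exact ⟨h, by abel⟩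
  · rintro ⟨x, y⟩ h
    simp only [mem_filter] at h
    simp [← h.2]
  · intro x _
    rfl

/-- The subset of `ZMod 109` whose indicator vector is the binary expansion of `m`. -/
def ofBits (m : ℕ) : Finset (ZMod 109) := univ.filter (fun x => m.testBit x.val = true)

theorem mem_ofBits {m : ℕ} {x : ZMod 109} : x ∈ ofBits m ↔ m.testBit x.val = true := by
  simp [ofBits]

/-- The periodic autocorrelation at shift `d` of the binary expansion of `m`. -/
def autocorrelation (m : ℕ) (d : ZMod 109) : ℕ :=
  (univ.filter (fun x : ZMod 109 =>
    (m.testBit x.val && m.testBit (x - d).val) = true)).card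

theorem card_filter_sub_eq_ofBits (m : ℕ) (d : ZMod 109) :
    ((ofBits m ×ˢ ofBits m).filter (fun p => p.1 - p.2 = d)).card = autocorrelation m d := by
  rw [card_filter_sub_eq, autocorrelation]
  congr 1
  ext x
  simp [mem_ofBits]

theorem B1_eq_ofBits : B1 = ofBits 272651854555632155614714051255378 := by
  have h : ∀ x : ZMod 109, x ∈ B1 ↔ Nat.testBit 272651854555632155614714051255378 x.val = true := by
    decide +kernel
  ext x
  rw [h, mem_ofBits]

theorem B2_eq_ofBits : B2 = ofBits 459456625862466354461078265554424 := by
  have h : ∀ x : ZMod 109, x ∈ B2 ↔ Nat.testBit 459456625862466354461078265554424 x.val = true := by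
    decide +kernel
  ext x
  rw [h, mem_ofBits]

theorem B3_eq_ofBits : B3 = ofBits 491291252973569955345216406545758 := by
  have h : ∀ x : ZMod 109, x ∈ B3 ↔ Nat.testBit 491291252973569955345216406545758 x.val = true := by
    decide +kernel
  ext x
  rw [h, mem_ofBits]

theorem B4_eq_ofBits : B4 = ofBits 597655088655946324782822385932198 := by
  have h : ∀ x : ZMod 109, x ∈ B4 ↔ Nat.testBit 597655088655946324782822385932198 x.val = true := by
    decide +kernel
  ext x
  rw [h, mem_ofBits]

theorem autocorrelation_sum : ∀ d : ZMod 109, d ≠ 0 →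
    autocorrelation 272651854555632155614714051255378 d +
    autocorrelation 459456625862466354461078265554424 d +
    autocorrelation 491291252973569955345216406545758 d +
    autocorrelation 597655088655946324782822385932198 d = 125 := by
  decide +kernel

theorem sds_B :
    B1.card = 54 ∧ B2.card = 57 ∧ B3.card = 60 ∧ B4.card = 63 ∧
    ∀ d : ZMod 109, d ≠ 0 →
      ((B1 ×ˢ B1).filter (fun p => p.1 - p.2 = d)).card +
      ((B2 ×ˢ B2).filter (fun p => p.1 - p.2 = d)).card +
      ((B3 ×ˢ B3).filter (fun p => p.1 - p.2 = d)).card +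
      ((B4 ×ˢ B4).filter (fun p => p.1 - p.2 = d)).card = 125 := by
  refine ⟨by decide +kernel, by decide +kernel, by decide +kernel, by decide +kernel, ?_⟩
  intro d hd
  rw [B1_eq_ofBits, B2_eq_ofBits, B3_eq_ofBits, B4_eq_ofBits]
  simp only [card_filter_sub_eq_ofBits]
  exact autocorrelation_sum d hd
end

section
/- There exists a skew-Hadamard matrix of order 988; that is, there exists a 988 × 988 integer matrix M with all entries ±1 such that M · Mᵀ = 988 · I_988 and M + Mᵀ = 2 · I_988. -/
open Matrix

section GoethalsSeidel

variable {G : Type*} [AddCommGroup G]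

/-- The Goethals–Seidel array of four functions on a finite abelian group. -/
def goethalsSeidel (a b c d : G → ℤ) : Matrix (Fin 4 × G) (Fin 4 × G) ℤ := fun x y =>
  !![a (x.2 - y.2), b (x.2 + y.2), c (x.2 + y.2), d (x.2 + y.2);
    -b (x.2 + y.2), a (x.2 - y.2), d (-(x.2 + y.2)), -c (-(x.2 + y.2));
    -c (x.2 + y.2), -d (-(x.2 + y.2)), a (x.2 - y.2), b (-(x.2 + y.2));
    -d (x.2 + y.2), c (-(x.2 + y.2)), -b (-(x.2 + y.2)), a (x.2 - y.2)] x.1 y.1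

theorem goethalsSeidel_eq_one_or {a b c d : G → ℤ} (ha : ∀ g, a g = 1 ∨ a g = -1)
    (hb : ∀ g, b g = 1 ∨ b g = -1) (hc : ∀ g, c g = 1 ∨ c g = -1)
    (hd : ∀ g, d g = 1 ∨ d g = -1) (x y : Fin 4 × G) :
    goethalsSeidel a b c d x y = 1 ∨ goethalsSeidel a b c d x y = -1 := by
  obtain ⟨p, i⟩ := x
  obtain ⟨q, j⟩ := y
  fin_cases p <;> fin_cases q <;>
    simp [goethalsSeidel, -neg_add_rev, neg_eq_iff_eq_neg, ha, hb, hc, hd, or_comm]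

theorem goethalsSeidel_add_transpose [DecidableEq G] {a b c d : G → ℤ} (ha0 : a 0 = 1)
    (ha : ∀ g, g ≠ 0 → a (-g) = -a g) :
    goethalsSeidel a b c d + (goethalsSeidel a b c d)ᵀ = (2 : ℤ) • 1 := by
  have key (i j : G) : a (i - j) + a (j - i) = if i = j then 2 else 0 := by
    split_ifs with h
    · simp [h, ha0]
    · rw [← neg_sub i j, ha _ (sub_ne_zero.mpr h), add_neg_cancel]
  ext ⟨p, i⟩ ⟨q, j⟩
  fin_cases p <;> fin_cases q <;>
    simp [goethalsSeidel, -neg_add_rev, Matrix.one_apply, key, add_comm j i]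

variable [Fintype G]

/-- The periodic cross-correlation of two functions on a finite abelian group. -/
def correlation (f g : G → ℤ) (s : G) : ℤ := ∑ u, f (u + s) * g u

/-- The convolution of two functions on a finite abelian group. -/
def cyclicConvolution (f g : G → ℤ) (s : G) : ℤ := ∑ u, f u * g (s - u)

theorem cyclicConvolution_comm (f g : G → ℤ) (s : G) :
    cyclicConvolution f g s = cyclicConvolution g f s :=
  Fintype.sum_equiv (Equiv.subLeft s) _ _ fun u => by simp [mul_comm]

theorem sum_sub_mul_sub (f g : G → ℤ) (i j : G) :
    ∑ k, f (i - k) * g (j - k) = correlation f g (i - j) :=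
  Fintype.sum_equiv (Equiv.subLeft j) _ _ fun k => by
    simp only [Equiv.subLeft_apply]; congr 2; abel

theorem sum_add_mul_add (f g : G → ℤ) (i j : G) :
    ∑ k, f (i + k) * g (j + k) = correlation f g (i - j) :=
  Fintype.sum_equiv (Equiv.addLeft j) _ _ fun k => by
    simp only [Equiv.coe_addLeft]; congr 2; abel

theorem sum_neg_mul_neg (f g : G → ℤ) (i j : G) :
    ∑ k, f (-(i + k)) * g (-(j + k)) = correlation g f (i - j) :=
  Fintype.sum_equiv ((Equiv.addLeft i).trans (Equiv.neg G)) _ _ fun k => by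
    simp only [Equiv.trans_apply, Equiv.coe_addLeft, Equiv.neg_apply]
    rw [mul_comm]; congr 2; abel

theorem sum_sub_mul_add (f g : G → ℤ) (i j : G) :
    ∑ k, f (i - k) * g (j + k) = cyclicConvolution f g (i + j) :=
  Fintype.sum_equiv (Equiv.subLeft i) _ _ fun k => by
    simp only [Equiv.subLeft_apply]; congr 2; abel

theorem sum_add_mul_sub (f g : G → ℤ) (i j : G) :
    ∑ k, f (i + k) * g (j - k) = cyclicConvolution g f (i + j) := by
  simp_rw [mul_comm (f _), sum_sub_mul_add, add_comm]

theorem sum_sub_mul_neg (f g : G → ℤ) (i j : G) :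
    ∑ k, f (i - k) * g (-(j + k)) = correlation f g (i + j) :=
  Fintype.sum_equiv ((Equiv.addLeft j).trans (Equiv.neg G)) _ _ fun k => by
    simp only [Equiv.trans_apply, Equiv.coe_addLeft, Equiv.neg_apply]; congr 2; abel

theorem sum_neg_mul_sub (f g : G → ℤ) (i j : G) :
    ∑ k, f (-(i + k)) * g (j - k) = correlation g f (i + j) := by
  simp_rw [mul_comm (f _), sum_sub_mul_neg, add_comm]

theorem sum_add_mul_neg (f g : G → ℤ) (i j : G) :
    ∑ k, f (i + k) * g (-(j + k)) = cyclicConvolution f g (i - j) :=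
  Fintype.sum_equiv (Equiv.addLeft i) _ _ fun k => by
    simp only [Equiv.coe_addLeft]; congr 2; abel

theorem sum_neg_mul_add (f g : G → ℤ) (i j : G) :
    ∑ k, f (-(i + k)) * g (j + k) = cyclicConvolution f g (j - i) := by
  simp_rw [mul_comm (f _), sum_add_mul_neg, cyclicConvolution_comm]

theorem goethalsSeidel_mul_transpose [DecidableEq G] {a b c d : G → ℤ} {m : ℤ}
    (h : ∀ s, correlation a a s + correlation b b s + correlation c c s + correlation d d s =
      if s = 0 then m else 0) :
    goethalsSeidel a b c d * (goethalsSeidel a b c d)ᵀ = m • 1 := by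
  ext ⟨p, i⟩ ⟨q, j⟩
  have hij := h (i - j)
  simp only [sub_eq_zero] at hij
  have hbc := cyclicConvolution_comm b c
  have hbd := cyclicConvolution_comm b d
  have hcd := cyclicConvolution_comm c d
  rw [Matrix.mul_apply, Fintype.sum_prod_type, Fin.sum_univ_four]
  fin_cases p <;> fin_cases q <;>
    simp [goethalsSeidel, -neg_add_rev, Matrix.one_apply, sum_sub_mul_sub, sum_add_mul_add,
      sum_neg_mul_neg, sum_sub_mul_add, sum_add_mul_sub, sum_sub_mul_neg, sum_neg_mul_sub,
      sum_add_mul_neg, sum_neg_mul_add, hbc, hbd, hcd] <;>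
    linarith

end GoethalsSeidel

/-- The sequence of signs given by the binary digits of `N`, a digit `1` standing for `-1`. -/
def signOfBits (N : ℕ) (i : ZMod 247) : ℤ := if N.testBit i.val then -1 else 1

theorem signOfBits_eq_one_or (N : ℕ) (i : ZMod 247) :
    signOfBits N i = 1 ∨ signOfBits N i = -1 := by
  unfold signOfBits
  split_ifs <;> simp

/-- The number of digits `1` among the last `k` binary digits of a natural number. -/
def bitCount : ℕ → ℕ → ℕ
  | 0, _ => 0
  | k + 1, x => x % 2 + bitCount k (x / 2)

theorem sum_range_testBit (k x : ℕ) :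
    ∑ i ∈ Finset.range k, (if x.testBit i then -1 else 1) = (k : ℤ) - 2 * bitCount k x := by
  induction k generalizing x with
  | zero => rfl
  | succ k ih =>
    simp only [Finset.sum_range_succ', Nat.testBit_succ, ih, bitCount, Nat.testBit_zero,
      decide_eq_true_eq]
    split_ifs <;> omega

/-- The number of `i < 247` such that the binary digits of `N < 2 ^ 247` at `i` and at `i + s`
modulo `247` differ. -/
def disagreements (N s : ℕ) : ℕ := bitCount 247 ((2 ^ 247 * N + N) >>> s ^^^ N)

theorem correlation_eq_sub_disagreements {N : ℕ} (hN : N < 2 ^ 247) (s : ZMod 247) :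
    correlation (signOfBits N) (signOfBits N) s = 247 - 2 * disagreements N s.val := by
  refine Eq.trans ?_ (sum_range_testBit 247 _)
  rw [correlation, ← Fin.sum_univ_eq_sum_range
    fun i => if ((2 ^ 247 * N + N) >>> s.val ^^^ N).testBit i then (-1 : ℤ) else 1]
  refine Finset.sum_congr rfl fun (u : ZMod 247) _ => ?_
  change _ = if ((2 ^ 247 * N + N) >>> s.val ^^^ N).testBit u.val then (-1 : ℤ) else 1
  have hrot : (2 ^ 247 * N + N).testBit (s.val + u.val) = N.testBit ((u + s).val) := by
    have hs := s.val_lt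
    have hu := u.val_lt
    rw [Nat.testBit_two_pow_mul_add _ hN, ZMod.val_add]
    split_ifs
    · exact congrArg N.testBit (by omega)
    · exact congrArg N.testBit (by omega)
  rw [Nat.testBit_xor, Nat.testBit_shiftRight, hrot, signOfBits, signOfBits]
  cases N.testBit (u + s).val <;> cases N.testBit u.val <;> rfl

/-- The block of skew type in a difference family on `ZMod 247`. -/
def bitsA : ℕ :=
  223511360434313737506303923342705242677120908205465340759775944587721113216

/-- The second block of the difference family. -/
def bitsB : ℕ :=
  53930410756269178930118739009111619462827188011177819081558450991773469040

/-- The third block of the difference family. -/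
def bitsC : ℕ :=
  185931286310593721812996836062275072358854862977095371098378730790150370550

/-- The fourth block of the difference family. -/
def bitsD : ℕ :=
  209676973735772634028513561187828679090628901145772211470176817810025168098

theorem signOfBits_bitsA_neg :
    ∀ s : ZMod 247, s ≠ 0 → signOfBits bitsA (-s) = -signOfBits bitsA s := by
  decide +kernel

theorem sum_disagreements_zero : disagreements bitsA 0 + disagreements bitsB 0 +
    disagreements bitsC 0 + disagreements bitsD 0 = 0 := by
  decide +kernel

theorem sum_disagreements_eq : ∀ s < 247, s ≠ 0 → disagreements bitsA s + disagreements bitsB s +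
    disagreements bitsC s + disagreements bitsD s = 494 := by
  decide +kernel

theorem correlation_signOfBits (s : ZMod 247) :
    correlation (signOfBits bitsA) (signOfBits bitsA) s +
      correlation (signOfBits bitsB) (signOfBits bitsB) s +
      correlation (signOfBits bitsC) (signOfBits bitsC) s +
      correlation (signOfBits bitsD) (signOfBits bitsD) s = if s = 0 then 988 else 0 := by
  rw [correlation_eq_sub_disagreements (by decide +kernel),
    correlation_eq_sub_disagreements (by decide +kernel),
    correlation_eq_sub_disagreements (by decide +kernel),
    correlation_eq_sub_disagreements (by decide +kernel)]
  split_ifs with h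
  · have := sum_disagreements_zero
    rw [h, ZMod.val_zero]
    omega
  · have := sum_disagreements_eq s.val s.val_lt (by simpa using h)
    omega

theorem exists_skew_hadamard_988 :
    ∃ M : Matrix (Fin 988) (Fin 988) ℤ,
      (∀ i j, M i j = 1 ∨ M i j = -1) ∧
      M * Mᵀ = (988 : ℤ) • 1 ∧
      M + Mᵀ = (2 : ℤ) • 1 := by
  have e : Fin 4 × ZMod 247 ≃ Fin 988 := Fintype.equivFinOfCardEq (by simp [ZMod.card])
  let M := goethalsSeidel (signOfBits bitsA) (signOfBits bitsB) (signOfBits bitsC)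
    (signOfBits bitsD)
  have hmul : M * Mᵀ = (988 : ℤ) • 1 := goethalsSeidel_mul_transpose correlation_signOfBits
  have hadd : M + Mᵀ = (2 : ℤ) • 1 :=
    goethalsSeidel_add_transpose (by decide +kernel) signOfBits_bitsA_neg
  have hone (m : ℤ) : (m • (1 : Matrix (Fin 4 × ZMod 247) (Fin 4 × ZMod 247) ℤ)).submatrix
      e.symm e.symm = m • 1 :=
    congrArg (fun N : Matrix (Fin 988) (Fin 988) ℤ => m • N) (submatrix_one_equiv e.symm)
  refine ⟨M.submatrix e.symm e.symm, fun i j => ?_, ?_, ?_⟩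
  · exact goethalsSeidel_eq_one_or (signOfBits_eq_one_or _) (signOfBits_eq_one_or _)
      (signOfBits_eq_one_or _) (signOfBits_eq_one_or _) _ _
  · rw [transpose_submatrix, submatrix_mul_equiv, hmul, hone]
  · exact (congrArg (submatrix · e.symm e.symm) hadd).trans (hone 2)
end
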